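/- Let Σ be a 2n×2n real symmetric positive definite matrix with eigenemittances ε₁,...,ε_n and projected emittances ε̃₁,...,ε̃_n. Then ε̃₁ + ε̃₂ + ... + ε̃_n ≥ ε₁ + ε₂ + ... + ε_n. -/

import Mathlib

open Matrix Polynomial

noncomputable section

/-- The 2×2 standard symplectic matrix. -/
def J2 : Matrix (Fin 2) (Fin 2) ℝ := !![0, 1; -1, 0]

/-- The 2n×2n block-diagonal symplectic matrix `diag(J₂, ..., J₂)`. -/
def Jblock (n : ℕ) : Matrix (Fin (2 * n)) (Fin (2 * n)) ℝ :=
  fun i j =>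
    if i.val / 2 = j.val / 2 then
      J2 ⟨i.val % 2, by omega⟩ ⟨j.val % 2, by omega⟩
    else 0

/-- The 2×2 block of a 2n×2n matrix at block position (m, k). -/
def blk {n : ℕ} (A : Matrix (Fin (2 * n)) (Fin (2 * n)) ℝ) (m k : Fin n) :
    Matrix (Fin 2) (Fin 2) ℝ :=
  fun i j =>
    A ⟨2 * m.val + i.val, by have := m.isLt; have := i.isLt; omega⟩
      ⟨2 * k.val + j.val, by have := k.isLt; have := j.isLt; omega⟩

/-- `S` has eigenemittances `ε`: the spectrum of `S · J_{2n}` (over ℂ, with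
multiplicity) is `±iε₁, ..., ±iε_n`. -/
def hasEigenemittances {n : ℕ} (S : Matrix (Fin (2 * n)) (Fin (2 * n)) ℝ)
    (ε : Fin n → ℝ) : Prop :=
  ((S * Jblock n).map (Complex.ofReal)).charpoly =
    ∏ m : Fin n, ((X - C (Complex.I * (ε m : ℂ))) * (X + C (Complex.I * (ε m : ℂ))))

lemma sum_pairs {M : Type*} [AddCommMonoid M] (n : ℕ) (f : Fin (2 * n) → M) :
    ∑ i, f i = ∑ m : Fin n, (f ⟨2 * m.val, by omega⟩ + f ⟨2 * m.val + 1, by omega⟩) := by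
  have e : ∑ i, f i = ∑ i : Fin (n * 2), f (Fin.cast (Nat.mul_comm n 2) i) :=
    (Equiv.sum_comp (finCongr (Nat.mul_comm n 2)) f).symm
  rw [e, ← Equiv.sum_comp finProdFinEquiv, Fintype.sum_prod_type]
  refine Finset.sum_congr rfl fun m _ => ?_
  rw [Fin.sum_univ_two]
  congr 2 <;> (apply Fin.ext; simp [finProdFinEquiv]; try omega)

lemma pair_bound (p q r s : ℝ) (hp : 0 < p) (hs : s ^ 2 = p * r - q ^ 2) (a b c d : ℝ) :
    |s * (2 * (a * d - b * c))| ≤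
      r * (a ^ 2 + b ^ 2) + p * (c ^ 2 + d ^ 2) - 2 * q * (a * c + b * d) := by
  rw [abs_le]
  constructor
  · have h : 0 ≤ p * (r * (a ^ 2 + b ^ 2) + p * (c ^ 2 + d ^ 2) - 2 * q * (a * c + b * d)
        + s * (2 * (a * d - b * c))) := by
      have : p * (r * (a ^ 2 + b ^ 2) + p * (c ^ 2 + d ^ 2) - 2 * q * (a * c + b * d)
        + s * (2 * (a * d - b * c))) = (p * c - q * a - s * b) ^ 2 + (p * d - q * b + s * a) ^ 2 := by
        linear_combination (-(a ^ 2 + b ^ 2)) * hs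
      rw [this]; positivity
    have := nonneg_of_mul_nonneg_right h hp
    linarith
  · have h : 0 ≤ p * (r * (a ^ 2 + b ^ 2) + p * (c ^ 2 + d ^ 2) - 2 * q * (a * c + b * d)
        - s * (2 * (a * d - b * c))) := by
      have : p * (r * (a ^ 2 + b ^ 2) + p * (c ^ 2 + d ^ 2) - 2 * q * (a * c + b * d)
        - s * (2 * (a * d - b * c))) = (p * c - q * a + s * b) ^ 2 + (p * d - q * b - s * a) ^ 2 := by
        linear_combination (-(a ^ 2 + b ^ 2)) * hs
      rw [this]; positivity
    have := nonneg_of_mul_nonneg_right h hp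
    linarith

lemma quad_J (n : ℕ) (w : Fin (2 * n) → ℂ) :
    ∑ i, ∑ j, star (w i) * (Complex.I * ((Jblock n i j : ℝ) : ℂ)) * w j =
      ∑ m : Fin n, Complex.I * (star (w ⟨2 * m.val, by omega⟩) * w ⟨2 * m.val + 1, by omega⟩
        - star (w ⟨2 * m.val + 1, by omega⟩) * w ⟨2 * m.val, by omega⟩) := by
  rw [sum_pairs]
  refine Finset.sum_congr rfl fun m _ => ?_
  rw [sum_pairs, sum_pairs, ← Finset.sum_add_distrib]
  rw [Finset.sum_eq_single m]
  · have h1 : (2 * m.val + 1) / 2 = m.val := by omega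
    have h2 : (2 * m.val + 1) % 2 = 1 := by omega
    simp [Jblock, J2, h1, h2]
    ring
  · intro k _ hk
    have hk' : m.val ≠ k.val := fun h => hk (Fin.ext h.symm)
    have h1 : ∀ k : ℕ, (2 * k + 1) / 2 = k := by omega
    simp [Jblock, h1, hk']
  · simp

lemma exists_W (n : ℕ) (S : Matrix (Fin (2 * n)) (Fin (2 * n)) ℝ) (hS : S.PosDef) :
    ∃ (W : Matrix (Fin (2 * n)) (Fin (2 * n)) ℂ) (l : Fin (2 * n) → ℝ),
      W * Wᴴ = S.map Complex.ofReal ∧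
      Wᴴ * (Complex.I • (Jblock n).map Complex.ofReal) * W =
        diagonal (fun i => (l i : ℂ)) := by
  obtain ⟨B, hB⟩ : ∃ B : Matrix (Fin (2 * n)) (Fin (2 * n)) ℝ, S = Bᴴ * B := by
    open scoped MatrixOrder in
    exact CStarAlgebra.nonneg_iff_eq_star_mul_self.mp hS.posSemidef.nonneg
  set C := B.map Complex.ofReal with hC
  have hSC : S.map Complex.ofReal = Cᴴ * C := by
    have : Cᴴ = (Bᴴ).map Complex.ofReal := by
      ext i j; simp [hC]
    rw [this, hB, hC]
    exact Matrix.map_mul (f := Complex.ofRealHom)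
  set K := Complex.I • (Jblock n).map Complex.ofReal with hK
  have hKh : Kᴴ = K := by
    ext i j
    have hJ : Jblock n j i = - Jblock n i j := by
      have : ∀ a b : Fin 2, J2 a b = - J2 b a := by
        intro a b; fin_cases a <;> fin_cases b <;> simp [J2]
      unfold Jblock
      by_cases h : i.val / 2 = j.val / 2
      · rw [if_pos h, if_pos h.symm, this]
      · rw [if_neg h, if_neg (Ne.symm h), neg_zero]
    simp [hK, hJ]
  have hA : (C * K * Cᴴ).IsHermitian := by
    simp [Matrix.IsHermitian, Matrix.conjTranspose_mul, hKh, Matrix.mul_assoc]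
  have hd := hA.conjStarAlgAut_star_eigenvectorUnitary
  rw [Unitary.conjStarAlgAut_star_apply] at hd
  have hU : (hA.eigenvectorUnitary : Matrix (Fin (2 * n)) (Fin (2 * n)) ℂ) *
      star (hA.eigenvectorUnitary : Matrix (Fin (2 * n)) (Fin (2 * n)) ℂ) = 1 :=
    Unitary.coe_mul_star_self hA.eigenvectorUnitary
  generalize (hA.eigenvectorUnitary : Matrix (Fin (2 * n)) (Fin (2 * n)) ℂ) = U at hd hU
  generalize hA.eigenvalues = l at hd
  rw [star_eq_conjTranspose] at hd hU
  refine ⟨Cᴴ * U, l, ?_, ?_⟩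
  · rw [hSC, conjTranspose_mul, conjTranspose_conjTranspose, Matrix.mul_assoc,
      ← Matrix.mul_assoc _ _ C, hU, Matrix.one_mul]
  · rw [conjTranspose_mul, conjTranspose_conjTranspose]
    simp only [Matrix.mul_assoc] at hd ⊢
    exact hd

lemma charpoly_I_smul (n : ℕ) (M : Matrix (Fin (2 * n)) (Fin (2 * n)) ℂ) (ε : Fin n → ℝ)
    (h : M.charpoly = ∏ m : Fin n, ((X - C (Complex.I * (ε m : ℂ))) *
      (X + C (Complex.I * (ε m : ℂ))))) :
    (Complex.I • M).charpoly = ∏ m : Fin n, ((X - C (ε m : ℂ)) * (X - C (-(ε m : ℂ)))) := by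
  apply Polynomial.funext
  intro x
  have h1 := congrArg (Polynomial.eval (-Complex.I * x)) h
  rw [eval_charpoly] at h1 ⊢
  have h2 : Matrix.scalar (Fin (2 * n)) x - Complex.I • M =
      Complex.I • (Matrix.scalar (Fin (2 * n)) (-Complex.I * x) - M) := by
    rw [smul_sub]
    congr 1
    ext i j
    simp [Matrix.diagonal_apply, Matrix.smul_apply]
    rw [← mul_assoc, Complex.I_mul_I]; simp
  rw [h2, det_smul, h1, Fintype.card_fin, pow_mul, Complex.I_sq, eval_prod, eval_prod]
  have h3 : ((-1 : ℂ)) ^ n = ∏ m : Fin n, (-1 : ℂ) := by simp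
  rw [h3, ← Finset.prod_mul_distrib]
  refine Finset.prod_congr rfl fun m _ => ?_
  simp only [eval_mul, eval_sub, eval_add, eval_X, eval_C]
  linear_combination (- x ^ 2 + (ε m : ℂ) ^ 2) * Complex.I_sq

lemma sum_abs (n : ℕ) (l : Fin (2 * n) → ℝ) (ε : Fin n → ℝ) (hpos : ∀ m, 0 < ε m)
    (h : ∏ i, (X - C (l i : ℂ)) = ∏ m : Fin n, ((X - C (ε m : ℂ)) * (X - C (-(ε m : ℂ))))) :
    ∑ i, |l i| = 2 * ∑ m, ε m := by
  have h1 := congrArg (fun p : ℂ[X] => (p.roots.map (fun z => ‖z‖)).sum) h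
  have e1 : (∏ i, (X - C (l i : ℂ))).roots = Finset.univ.val.map (fun i => (l i : ℂ)) := by
    rw [Polynomial.roots_prod]
    · simp
    · simp [Finset.prod_ne_zero_iff, Polynomial.X_sub_C_ne_zero]
  have e2 : (∏ m : Fin n, ((X - C (ε m : ℂ)) * (X - C (-(ε m : ℂ))))).roots =
      Finset.univ.val.map (fun m => (ε m : ℂ)) + Finset.univ.val.map (fun m => -(ε m : ℂ)) := by
    rw [Finset.prod_mul_distrib, Polynomial.roots_mul, Polynomial.roots_prod,
      Polynomial.roots_prod]
    · simp only [Polynomial.roots_X_sub_C, Multiset.bind_singleton]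
    · exact Finset.prod_ne_zero_iff.mpr fun _ _ => Polynomial.X_sub_C_ne_zero _
    · exact Finset.prod_ne_zero_iff.mpr fun _ _ => Polynomial.X_sub_C_ne_zero _
    · exact mul_ne_zero (Finset.prod_ne_zero_iff.mpr fun _ _ => Polynomial.X_sub_C_ne_zero _)
        (Finset.prod_ne_zero_iff.mpr fun _ _ => Polynomial.X_sub_C_ne_zero _)
  simp only [e1, e2, Multiset.map_map, Multiset.map_add, Multiset.sum_add, Function.comp_def,
    norm_neg, Complex.norm_real, Real.norm_eq_abs, abs_of_pos (hpos _)] at h1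
  change ∑ i, |l i| = ∑ m, ε m + ∑ m, ε m at h1
  rw [h1]; ring

/-- The sum of the projected emittances is at least the sum of the
eigenemittances. -/
theorem stmt14 (n : ℕ) (S : Matrix (Fin (2 * n)) (Fin (2 * n)) ℝ) (ε : Fin n → ℝ)
    (hS : S.PosDef) (hpos : ∀ m, 0 < ε m) (hε : hasEigenemittances S ε) :
    ∑ m : Fin n, ε m ≤ ∑ m : Fin n, Real.sqrt (blk S m m).det := by
  obtain ⟨W, l, hW, hl⟩ := exists_W n S hS
  set K := Complex.I • (Jblock n).map Complex.ofReal with hK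
  -- the spectrum
  have hsum : ∑ i, |l i| = 2 * ∑ m, ε m := by
    apply sum_abs n l ε hpos
    rw [← charpoly_I_smul n _ ε hε, ← charpoly_diagonal, ← hl, Matrix.mul_assoc,
      charpoly_mul_comm, Matrix.mul_assoc, hW, charpoly_mul_comm]
    congr 1
    have : (S * Jblock n).map Complex.ofReal =
        S.map Complex.ofReal * (Jblock n).map Complex.ofReal :=
      Matrix.map_mul (f := Complex.ofRealHom)
    rw [this, hK, Matrix.mul_smul]
  -- indices
  let a : Fin n → Fin (2 * n) := fun m => ⟨2 * m.val, by omega⟩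
  let b : Fin n → Fin (2 * n) := fun m => ⟨2 * m.val + 1, by omega⟩
  let s : Fin n → ℝ := fun m => Real.sqrt (blk S m m).det
  have hsymm : ∀ i j, S i j = S j i := fun i j => by
    have := congrFun (congrFun hS.isHermitian i) j
    simpa using this.symm
  have hdet : ∀ m, (blk S m m).det = S (a m) (a m) * S (b m) (b m) - S (a m) (b m) ^ 2 := by
    intro m
    rw [det_fin_two, sq]
    change S (a m) (a m) * S (b m) (b m) - S (a m) (b m) * S (b m) (a m) = _
    rw [hsymm (b m) (a m)]
  have hdpos : ∀ m, 0 < (blk S m m).det := by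
    intro m
    have hinj : Function.Injective (fun i : Fin 2 => (⟨2 * m.val + i.val, by omega⟩ : Fin (2 * n))) := by
      intro i j hij
      simp only [Fin.mk.injEq] at hij
      exact Fin.ext (by omega)
    exact (hS.submatrix hinj).det_pos
  have hspos : ∀ m, 0 < s m := fun m => Real.sqrt_pos.mpr (hdpos m)
  have hs2 : ∀ m, s m ^ 2 = S (a m) (a m) * S (b m) (b m) - S (a m) (b m) ^ 2 := fun m => by
    rw [← hdet]; exact Real.sq_sqrt (hdpos m).le
  have hWe : ∀ i j, ∑ k, W i k * star (W j k) = (S i j : ℂ) := by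
    intro i j
    have := congrFun (congrFun hW i) j
    simpa [Matrix.mul_apply] using this
  have hre : ∀ i j, ∑ k, ((W i k).re * (W j k).re + (W i k).im * (W j k).im) = S i j := by
    intro i j
    have := congrArg Complex.re (hWe i j)
    simpa [Complex.mul_re] using this
  have hlk : ∀ k, l k = ∑ m, -(2 * ((W (a m) k).re * (W (b m) k).im
      - (W (a m) k).im * (W (b m) k).re)) := by
    intro k
    have h1 := congrFun (congrFun hl k) k
    have h2 := quad_J n (fun i => W i k)
    have h3 : (Wᴴ * K * W) k k =
        ∑ i, ∑ j, star (W i k) * (Complex.I * ((Jblock n i j : ℝ) : ℂ)) * W j k := by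
      rw [Finset.sum_comm]
      rw [Matrix.mul_apply]
      refine Finset.sum_congr rfl fun j _ => ?_
      rw [Matrix.mul_apply, Finset.sum_mul]
      rfl
    rw [h3, h2, diagonal_apply_eq] at h1
    have h4 := congrArg Complex.re h1
    rw [Complex.ofReal_re, Complex.re_sum] at h4
    rw [← h4]
    refine Finset.sum_congr rfl fun m _ => ?_
    simp [a, b]
    ring
  have hbound : ∀ k, |l k| ≤ ∑ m, (s m)⁻¹ *
      (S (b m) (b m) * ((W (a m) k).re * (W (a m) k).re + (W (a m) k).im * (W (a m) k).im)
      + S (a m) (a m) * ((W (b m) k).re * (W (b m) k).re + (W (b m) k).im * (W (b m) k).im)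
      - 2 * S (a m) (b m) *
        ((W (a m) k).re * (W (b m) k).re + (W (a m) k).im * (W (b m) k).im)) := by
    intro k
    rw [hlk k]
    refine (Finset.abs_sum_le_sum_abs _ _).trans (Finset.sum_le_sum fun m _ => ?_)
    rw [abs_neg, le_inv_mul_iff₀ (hspos m)]
    have := pair_bound _ _ _ _ (hS.diag_pos (i := a m)) (hs2 m) (W (a m) k).re (W (a m) k).im
      (W (b m) k).re (W (b m) k).im
    rw [abs_mul, abs_of_pos (hspos m)] at this
    simpa only [sq] using this
  have htot : ∑ k, |l k| ≤ ∑ m, 2 * s m := by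
    refine (Finset.sum_le_sum fun k _ => hbound k).trans (le_of_eq ?_)
    rw [Finset.sum_comm]
    refine Finset.sum_congr rfl fun m _ => ?_
    rw [← Finset.mul_sum, Finset.sum_sub_distrib, Finset.sum_add_distrib, ← Finset.mul_sum,
      ← Finset.mul_sum, ← Finset.mul_sum, hre, hre, hre, inv_mul_eq_iff_eq_mul₀ (hspos m).ne']
    linear_combination (-2) * hs2 m
  rw [hsum, ← Finset.mul_sum] at htot
  change ∑ m, ε m ≤ ∑ m, s m
  linarith
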